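/- arXiv:1610.04750 — 2 statements merged into one kernel-verified Lean document; each statement's English description precedes it below -/
import Mathlib

section
/- Let P(x) = x³ + x² + 1 with roots r₁, r₂, r₃ ∈ ℂ. Then Σ_{n=-∞}^{∞} (-1)^n / (n³ + n² + 1) = (2πi/31) Σ_{j=1}^{3} (-3 - 9r_j + 2r_j^{-1}) / (e^{-i r_j π} - e^{i r_j π}). -/
open Complex Filter Asymptotics in
lemma summable_inv_sub_sub_inv (x : ℂ) :
    Summable fun n : ℤ ↦ ((n : ℂ) - x)⁻¹ - (n : ℂ)⁻¹ := by
  have h : Summable fun n : ℤ ↦ (((n : ℂ) - x) * n)⁻¹ := by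
    apply EisensteinSeries.summable_inv_of_isBigO_rpow_inv (a := 2) (by norm_num)
    have h1 := EisensteinSeries.linear_inv_isBigO_right (-1) x
    have h2 := EisensteinSeries.linear_inv_isBigO_right 0 x
    refine ((h1.mul h2).congr_left fun n ↦ ?_).congr_right fun n ↦ ?_
    · rw [mul_inv]; push_cast; ring_nf
    · simp [pow_two]
  have h' := h.mul_left x
  have hs : Set.Finite {n : ℤ | n = 0 ∨ (n : ℂ) = x} := by
    refine (Set.finite_singleton (0 : ℤ)).union ?_
    exact Set.Subsingleton.finite fun a ha b hb ↦ by
      have : (a : ℂ) = b := Eq.trans ha (Eq.symm hb)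
      exact_mod_cast this
  refine (summable_congr_cofinite ?_).mpr h'
  filter_upwards [hs.compl_mem_cofinite] with n hn
  simp only [Set.mem_compl_iff, Set.mem_ofPred_eq, not_or] at hn
  have h0 : (n : ℂ) ≠ 0 := by exact_mod_cast hn.1
  have h1 : (n : ℂ) - x ≠ 0 := sub_ne_zero.mpr hn.2
  field_simp
  ring

lemma hasSum_inv_sub_sub_inv {x : ℂ} (hx : x ∈ Complex.integerComplement) :
    HasSum (fun n : ℤ ↦ ((n : ℂ) - x)⁻¹ - (n : ℂ)⁻¹)
      (-(Real.pi * Complex.cot (Real.pi * x))) := by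
  have hs := (summable_inv_sub_sub_inv x).hasSum
  have h1 := (hasSum_nat_add_iff' 1).mpr hs.nat_add_neg
  have h2 := (summable_cotTerm hx).hasSum.neg
  rw [show ∑' n, cotTerm x n = _ from (cot_series_rep' hx).symm] at h2
  have h3 := h1.unique (h2.congr_fun ?_)
  · convert hs using 1
    simp at h3
    linear_combination -h3
  · intro n
    have e1 : (n : ℂ) + 1 - x = -(x - (n + 1)) := by ring
    have e2 : -((n : ℂ) + 1) - x = -(x + (n + 1)) := by ring
    simp only [cotTerm, one_div]
    push_cast
    rw [e1, e2, inv_neg, inv_neg, inv_neg]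
    ring

lemma Complex.cot_half_sub_cot {z : ℂ} (hz : sin z ≠ 0) :
    cot (z / 2) - cot z = (sin z)⁻¹ := by
  obtain ⟨w, rfl⟩ : ∃ w, z = 2 * w := ⟨z / 2, by ring⟩
  rw [show 2 * w / 2 = w by ring, cot, cot, sin_two_mul, cos_two_mul]
  rw [sin_two_mul] at hz
  have hs : sin w ≠ 0 := by rintro h; simp [h] at hz
  have hc : cos w ≠ 0 := by rintro h; simp [h] at hz
  field_simp
  ring

lemma hasSum_neg_one_zpow_mul_inv_sub_sub_inv {x : ℂ} (hx : x ∈ Complex.integerComplement) :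
    HasSum (fun n : ℤ ↦ (-1 : ℂ) ^ n * (((n : ℂ) - x)⁻¹ - (n : ℂ)⁻¹))
      (-(Real.pi / Complex.sin (Real.pi * x))) := by
  have hx2 : x / 2 ∈ Complex.integerComplement := by
    rintro ⟨n, hn⟩
    exact hx ⟨2 * n, by push_cast; rw [hn]; ring⟩
  have hinj : Function.Injective fun n : ℤ ↦ 2 * n := fun a b h ↦ by simpa using h
  have heven : HasSum (fun n : ℤ ↦ if Even n then ((n : ℂ) - x)⁻¹ - (n : ℂ)⁻¹ else 0)
      (2⁻¹ * -(Real.pi * Complex.cot (Real.pi * (x / 2)))) := by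
    rw [← hinj.hasSum_iff]
    · refine ((hasSum_inv_sub_sub_inv hx2).mul_left 2⁻¹).congr_fun fun n ↦ ?_
      have e : (2 : ℂ) * n - x = 2 * (n - x / 2) := by ring
      simp [e]
      ring
    · intro n hn
      refine if_neg fun h ↦ hn ?_
      obtain ⟨k, hk⟩ := h
      exact ⟨k, by simp only; lia⟩
  have h := (heven.mul_left 2).sub (hasSum_inv_sub_sub_inv hx)
  have hcsc := Complex.cot_half_sub_cot (sin_pi_mul_ne_zero hx)
  rw [show -(Real.pi / Complex.sin (Real.pi * x)) =
      2 * (2⁻¹ * -(Real.pi * Complex.cot (Real.pi * (x / 2)))) -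
        -(Real.pi * Complex.cot (Real.pi * x)) by
    rw [div_eq_mul_inv, ← hcsc, mul_div_assoc]; ring]
  refine h.congr_fun fun n ↦ ?_
  rcases Int.even_or_odd n with hn | hn
  · simp [hn, hn.neg_one_zpow]; ring
  · simp [Int.not_even_iff_odd.mpr hn, hn.neg_one_zpow]

theorem alt_series_cubic (r : Fin 3 → ℂ)
    (hr : ∀ x : ℂ, x ^ 3 + x ^ 2 + 1 = ∏ j, (x - r j)) :
    ∑' n : ℤ, (-1 : ℂ) ^ n / ((n : ℂ) ^ 3 + (n : ℂ) ^ 2 + 1) =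
      (2 * Real.pi * Complex.I / 31) *
        ∑ j, (-3 - 9 * r j + 2 * (r j)⁻¹) /
          (Complex.exp (-Complex.I * r j * Real.pi) - Complex.exp (Complex.I * r j * Real.pi)) := by
  have hP : ∀ j, r j ^ 3 + r j ^ 2 + 1 = 0 := fun j ↦
    (hr (r j)).trans (Finset.prod_eq_zero (Finset.mem_univ j) (sub_self _))
  have hint : ∀ n : ℤ, (n : ℂ) ^ 3 + (n : ℂ) ^ 2 + 1 ≠ 0 := by
    intro n hn
    have h : n ^ 3 + n ^ 2 + 1 = 0 := by exact_mod_cast hn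
    have h2 : Even (n ^ 3 + n ^ 2 + 1) := by simp [h]
    simp only [Int.even_add, Int.even_pow, Int.not_even_one] at h2
    tauto
  have hmem : ∀ j, r j ∈ Complex.integerComplement := by
    rintro j ⟨n, hn⟩
    exact hint n (by rw [hn]; exact hP j)
  have hinv : ∀ j, (r j)⁻¹ = -(r j ^ 2 + r j) := fun j ↦
    inv_eq_of_mul_eq_one_right (by linear_combination -hP j)
  -- first two power sums of the roots
  have hr' : ∀ x : ℂ, x ^ 3 + x ^ 2 + 1 = (x - r 0) * (x - r 1) * (x - r 2) := fun x ↦ by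
    rw [hr x, Fin.prod_univ_three]
  have s1 : r 0 + r 1 + r 2 = -1 := by
    linear_combination 1 / 2 * hr' 1 + 1 / 2 * hr' (-1) - hr' 0
  have e2 : r 0 * r 1 + r 0 * r 2 + r 1 * r 2 = 0 := by
    linear_combination 1 / 2 * hr' (-1) - 1 / 2 * hr' 1
  have s2 : r 0 ^ 2 + r 1 ^ 2 + r 2 ^ 2 = 1 := by
    linear_combination (r 0 + r 1 + r 2 - 1) * s1 - 2 * e2
  have hpartial : ∀ n : ℤ, 1 / ((n : ℂ) ^ 3 + (n : ℂ) ^ 2 + 1) =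
      ∑ j, (-3 - 9 * r j + 2 * (r j)⁻¹) / 31 * (((n : ℂ) - r j)⁻¹ - (n : ℂ)⁻¹) := by
    intro n
    have hn : ∀ j, ((n : ℂ) - r j)⁻¹ =
        ((n : ℂ) ^ 2 + (r j + 1) * n + r j * (r j + 1)) / ((n : ℂ) ^ 3 + (n : ℂ) ^ 2 + 1) := by
      intro j
      refine inv_eq_of_mul_eq_one_right ?_
      rw [← mul_div_assoc, div_eq_one_iff_eq (hint n)]
      linear_combination -hP j
    have hz : ∑ j, (-3 - 9 * r j + 2 * (r j)⁻¹) / 31 = 0 := by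
      simp only [hinv, Fin.sum_univ_three]
      linear_combination -11 / 31 * s1 - 2 / 31 * s2
    simp only [mul_sub, Finset.sum_sub_distrib, ← Finset.sum_mul, hz, zero_mul, sub_zero]
    simp only [hn, ← mul_div_assoc, ← Finset.sum_div]
    congr 1
    simp only [hinv, Fin.sum_univ_three]
    linear_combination
      (2 * n + 2 * r 0 + 11) / 31 * hP 0 + (2 * n + 2 * r 1 + 11) / 31 * hP 1 +
      (2 * n + 2 * r 2 + 11) / 31 * hP 2 + (11 * n ^ 2 + 14 * n + 1 : ℂ) / 31 * s1 +
      (2 * n ^ 2 + 11 * n + 3 : ℂ) / 31 * s2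
  have hsum := hasSum_sum fun j (_ : j ∈ Finset.univ) ↦
    (hasSum_neg_one_zpow_mul_inv_sub_sub_inv (hmem j)).mul_left
      ((-3 - 9 * r j + 2 * (r j)⁻¹) / 31)
  have hterm : ∀ n : ℤ, (-1 : ℂ) ^ n / ((n : ℂ) ^ 3 + (n : ℂ) ^ 2 + 1) =
      ∑ j, (-3 - 9 * r j + 2 * (r j)⁻¹) / 31 *
        ((-1 : ℂ) ^ n * (((n : ℂ) - r j)⁻¹ - (n : ℂ)⁻¹)) := by
    intro n
    rw [div_eq_mul_one_div, hpartial, Finset.mul_sum]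
    exact Finset.sum_congr rfl fun j _ ↦ by ring
  rw [(hsum.congr_fun hterm).tsum_eq, Finset.mul_sum]
  refine Finset.sum_congr rfl fun j _ ↦ ?_
  have hsin := sin_pi_mul_ne_zero (hmem j)
  have hexp : Complex.exp (-Complex.I * r j * Real.pi) - Complex.exp (Complex.I * r j * Real.pi) =
      -2 * Complex.I * Complex.sin (Real.pi * r j) := by
    rw [Complex.sin, show -Complex.I * r j * Real.pi = -(Real.pi * r j) * Complex.I by ring,
      show Complex.I * r j * Real.pi = Real.pi * r j * Complex.I by ring]
    linear_combination (Complex.exp (-(Real.pi * r j) * Complex.I) -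
      Complex.exp (Real.pi * r j * Complex.I)) * Complex.I_sq
  rw [hexp]
  field_simp [Complex.I_ne_zero]
end

section
/- Let P(x) = x³ + x² + 1 with roots r₁, r₂, r₃. Then Σ_{n=-∞}^{∞} n²/(n³ + n² + 1) (interpreted as the symmetric limit lim_{N→∞} Σ_{n=-N}^{N}) equals (πi/31) Σ_{j=1}^{3} (9 - 4r_j - 6r_j^{-1}) · (e^{-i r_j π} + e^{i r_j π})/(e^{-i r_j π} - e^{i r_j π}). -/
open Filter

open Finset in
lemma sum_Icc_one_div_int_sub (a : ℂ) (N : ℕ) :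
    ∑ n ∈ Icc (-(N : ℤ)) (N : ℤ), 1 / ((n : ℂ) - a) =
      -(1 / a + ∑ j ∈ range N, cotTerm a j) := by
  induction N with
  | zero => simp
  | succ N ih =>
    rw [sum_range_succ, Nat.cast_add, Nat.cast_one, Icc_succ_succ, sum_union (by simp),
      sum_pair (by lia), ih]
    have h₁ : 1 / ((N : ℂ) + 1 - a) = -(1 / (a - (N + 1))) := by
      rw [← neg_sub a, one_div_neg_eq_neg_one_div]
    have h₂ : 1 / (-((N : ℂ) + 1) - a) = -(1 / (a + (N + 1))) := by
      rw [← one_div_neg_eq_neg_one_div]; ring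
    simp only [cotTerm]
    push_cast
    rw [h₁, h₂]
    ring

lemma tendsto_sum_Icc_one_div_int_sub {a : ℂ} (ha : a ∈ Complex.integerComplement) :
    Tendsto (fun N : ℕ => ∑ n ∈ Finset.Icc (-(N : ℤ)) (N : ℤ), 1 / ((n : ℂ) - a)) atTop
      (nhds (-(Real.pi * Complex.cot (Real.pi * a)))) := by
  simp_rw [sum_Icc_one_div_int_sub]
  have h := ((tendsto_logDeriv_euler_cot_sub ha).const_add (1 / a)).neg
  rwa [add_sub_cancel] at h

lemma neg_cot_pi_mul_eq_exp_ratio (a : ℂ) :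
    -(Real.pi * Complex.cot (Real.pi * a)) = Real.pi * Complex.I *
      ((Complex.exp (-Complex.I * a * Real.pi) + Complex.exp (Complex.I * a * Real.pi)) /
        (Complex.exp (-Complex.I * a * Real.pi) - Complex.exp (Complex.I * a * Real.pi))) := by
  have h₁ : -Complex.I * a * Real.pi = -(Real.pi * a) * Complex.I := by ring
  have h₂ : Complex.I * a * Real.pi = Real.pi * a * Complex.I := by ring
  rw [Complex.cot, Complex.cos, Complex.sin, h₁, h₂]
  set u := Complex.exp (Real.pi * a * Complex.I)
  set v := Complex.exp (-(Real.pi * a) * Complex.I)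
  rcases eq_or_ne (v - u) 0 with h | h
  · simp [h]
  · field_simp
    rw [Complex.I_sq]
    ring

lemma mem_integerComplement_of_cubic {a : ℂ} (ha : a ^ 3 + a ^ 2 + 1 = 0) :
    a ∈ Complex.integerComplement := by
  rintro ⟨n, rfl⟩
  have h : n ^ 3 + n ^ 2 + 1 = 0 := by exact_mod_cast ha
  have h₂ : Even (n ^ 2 * (n + 1)) := by
    rcases Int.even_or_odd n with hn | hn
    · exact (hn.pow_of_ne_zero two_ne_zero).mul_right _
    · exact hn.add_one.mul_left _
  obtain ⟨k, hk⟩ := h₂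
  have : n ^ 2 * (n + 1) = n ^ 3 + n ^ 2 := by ring
  lia

lemma cubic_partial_fractions {a b c x : ℂ} (h₁ : a + b + c = -1)
    (h₂ : a * b + a * c + b * c = 0) (h₃ : a * b * c = -1)
    (hxa : x - a ≠ 0) (hxb : x - b ≠ 0) (hxc : x - c ≠ 0) :
    x ^ 2 / ((x - a) * (x - b) * (x - c)) =
      (9 - 4 * a - 6 * a⁻¹) / 31 * (1 / (x - a)) + (9 - 4 * b - 6 * b⁻¹) / 31 * (1 / (x - b)) +
        (9 - 4 * c - 6 * c⁻¹) / 31 * (1 / (x - c)) := by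
  have ia : a⁻¹ = -(b * c) := inv_eq_of_mul_eq_one_right (by linear_combination -h₃)
  have ib : b⁻¹ = -(a * c) := inv_eq_of_mul_eq_one_right (by linear_combination -h₃)
  have ic : c⁻¹ = -(a * b) := inv_eq_of_mul_eq_one_right (by linear_combination -h₃)
  rw [ia, ib, ic]
  field_simp
  linear_combination (4 * x ^ 2 + 18 * x + 12 * (a * b * c)) * h₁ +
    (-6 * x ^ 2 - 8 * x + 6 * x * (a + b + c) - 9 - 6 * (a * b + a * c + b * c)) * h₂ -
    18 * x * h₃

theorem symm_series_cubic (r : Fin 3 → ℂ)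
    (hr : ∀ x : ℂ, x ^ 3 + x ^ 2 + 1 = ∏ j, (x - r j)) :
    Tendsto (fun N : ℕ => ∑ n ∈ Finset.Icc (-(N : ℤ)) (N : ℤ),
        (n : ℂ) ^ 2 / ((n : ℂ) ^ 3 + (n : ℂ) ^ 2 + 1)) atTop
      (nhds ((Real.pi * Complex.I / 31) *
        ∑ j, (9 - 4 * r j - 6 * (r j)⁻¹) *
          ((Complex.exp (-Complex.I * r j * Real.pi) + Complex.exp (Complex.I * r j * Real.pi)) /
            (Complex.exp (-Complex.I * r j * Real.pi) - Complex.exp (Complex.I * r j * Real.pi))))) := by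
  have hmem (j : Fin 3) : r j ∈ Complex.integerComplement :=
    mem_integerComplement_of_cubic <| (hr (r j)).trans <|
      Finset.prod_eq_zero (Finset.mem_univ j) (sub_self _)
  have hsub (j : Fin 3) (n : ℤ) : (n : ℂ) - r j ≠ 0 :=
    sub_ne_zero.2 fun h => hmem j ⟨n, h⟩
  simp only [Fin.prod_univ_three] at hr
  have h₁ : r 0 + r 1 + r 2 = -1 := by
    linear_combination (hr 1 + hr (-1)) / 2 - hr 0
  have h₂ : r 0 * r 1 + r 0 * r 2 + r 1 * r 2 = 0 := by
    linear_combination (hr (-1) - hr 1) / 2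
  have h₃ : r 0 * r 1 * r 2 = -1 := by linear_combination hr 0
  have hterm (n : ℤ) : (n : ℂ) ^ 2 / ((n : ℂ) ^ 3 + (n : ℂ) ^ 2 + 1) =
      ∑ j, (9 - 4 * r j - 6 * (r j)⁻¹) / 31 * (1 / ((n : ℂ) - r j)) := by
    rw [hr, Fin.sum_univ_three,
      cubic_partial_fractions h₁ h₂ h₃ (hsub 0 n) (hsub 1 n) (hsub 2 n)]
  have hlim := tendsto_finsetSum Finset.univ fun j _ =>
    (tendsto_sum_Icc_one_div_int_sub (hmem j)).const_mul ((9 - 4 * r j - 6 * (r j)⁻¹) / 31)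
  simp_rw [neg_cot_pi_mul_eq_exp_ratio] at hlim
  convert hlim using 2 with N
  · simp_rw [hterm, Finset.mul_sum]
    exact Finset.sum_comm
  · rw [Finset.mul_sum]
    exact Finset.sum_congr rfl fun j _ => by ring
end
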